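/- arXiv:2202.08677 — 2 statements merged into one kernel-verified Lean document; each statement's English description precedes it below -/
import Mathlib

section
/- Let n, m be positive integers, let U ⊆ ℂⁿ be a nonempty connected open set, and let f : U → ℂᵐ be a ℂ-analytic map whose image f(U) has nonempty interior in ℂᵐ. Then the set of points x ∈ U at which the Fréchet derivative Df(x) : ℂⁿ → ℂᵐ is a surjective ℂ-linear map is dense in U. -/
open Set Filter Topology

/-- Images that are locally meagre are meagre. -/
lemma isMeagre_image_of_local {E F : Type} [TopologicalSpace E] [SecondCountableTopology E]
    [TopologicalSpace F] (f : E → F) (S : Set E)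
    (h : ∀ x ∈ S, ∃ N ∈ 𝓝 x, IsMeagre (f '' (S ∩ N))) : IsMeagre (f '' S) := by
  choose! N hN hm using h
  obtain ⟨t, htS, htc, hcov⟩ := TopologicalSpace.countable_cover_nhdsWithin
    (f := N) (s := S) (fun x hx => mem_nhdsWithin_of_mem_nhds (hN x hx))
  refine (isMeagre_biUnion htc (f := fun x => f '' (S ∩ N x)) fun x hx => hm x (htS hx)).mono ?_
  rintro _ ⟨x, hx, rfl⟩
  obtain ⟨i, hi, hxi⟩ := mem_iUnion₂.1 (hcov hx)
  exact mem_iUnion₂.2 ⟨i, hi, mem_image_of_mem f ⟨hx, hxi⟩⟩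

lemma isOpen_surjective_clm (E F : Type) [NormedAddCommGroup E] [NormedSpace ℂ E]
    [NormedAddCommGroup F] [NormedSpace ℂ F] [FiniteDimensional ℂ F] :
    IsOpen {T : E →L[ℂ] F | Function.Surjective T} := by
  convert isOpen_setOfPred_nat_le_rank (𝕜 := ℂ) (E := E) (F := F) (Module.finrank ℂ F) using 1
  ext T
  simp only [mem_ofPred_eq]
  rw [LinearMap.rank, ← Module.finrank_eq_rank, Nat.cast_le]
  constructor
  · intro h
    have h2 : LinearMap.range (T : E →ₗ[ℂ] F) = ⊤ := LinearMap.range_eq_top.2 h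
    rw [h2, finrank_top]
  · intro h
    have h2 : LinearMap.range (T : E →ₗ[ℂ] F) = ⊤ :=
      Submodule.eq_top_of_finrank_eq (le_antisymm (Submodule.finrank_le _) h)
    exact LinearMap.range_eq_top.1 h2

/-- Local analytic parametrization of level sets of a submersive function. -/
lemma level_param {E : Type} [NormedAddCommGroup E] [NormedSpace ℂ E] [FiniteDimensional ℂ E]
    (U : Set E) (hU : IsOpen U) (w : E → ℂ) (p : E) (hp : p ∈ U) (hw : AnalyticAt ℂ w p)
    (hd : fderiv ℂ w p ≠ 0) :
    ∃ N ∈ 𝓝 p, ∀ c : ℂ, ∃ (V : Set (fderiv ℂ w p).ker) (γ : (fderiv ℂ w p).ker → E),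
      IsOpen V ∧ AnalyticOnNhd ℂ γ V ∧ (∀ y ∈ V, γ y ∈ U ∧ w (γ y) = c) ∧
      ∀ x ∈ N, w x = c → ∃ y ∈ V, γ y = x := by
  have : CompleteSpace E := FiniteDimensional.complete ℂ E
  set l := fderiv ℂ w p with hl
  obtain ⟨v, hv⟩ : ∃ v, l v ≠ 0 := by
    by_contra! h
    exact hd (ContinuousLinearMap.ext h)
  let r : ℂ →L[ℂ] E := ContinuousLinearMap.toSpanSingleton ℂ ((l v)⁻¹ • v)
  have hr : Function.RightInverse r l := by
    intro z
    simp [r, hv]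
  let A := ContinuousLinearEquiv.equivOfRightInverse l r hr
  let P : E →L[ℂ] l.ker := l.projKerOfRightInverse r hr
  let Φ : E → ℂ × l.ker := fun x => (w x, P x)
  have hΦa : AnalyticAt ℂ Φ p := hw.prod (P.analyticAt p)
  have hΦ : HasStrictFDerivAt Φ (A : E →L[ℂ] ℂ × l.ker) p := by
    have h1 : HasStrictFDerivAt w l p := hw.hasStrictFDerivAt
    exact h1.prodMk P.hasStrictFDerivAt
  let e := hΦ.toOpenPartialHomeomorph Φ
  have hecoe : (e : E → ℂ × l.ker) = Φ := hΦ.toOpenPartialHomeomorph_coe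
  have hps : p ∈ e.source := hΦ.mem_toOpenPartialHomeomorph_source
  have hsa : AnalyticAt ℂ e.symm (e p) :=
    e.analyticAt_symm' (i := A) hps (by rw [hecoe]; exact hΦa)
      (by rw [hecoe]; exact hΦ.hasFDerivAt.fderiv)
  have hW : ∀ᶠ z in 𝓝 (e p), z ∈ e.target ∧ AnalyticAt ℂ e.symm z ∧ e.symm z ∈ U := by
    refine (e.open_target.eventually_mem (e.map_source hps)).and (hsa.eventually_analyticAt.and ?_)
    apply hsa.continuousAt.eventually_mem
    rw [e.left_inv hps]
    exact hU.mem_nhds hp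
  obtain ⟨W, hWs, hWo, hWp⟩ := eventually_nhds_iff.1 hW
  refine ⟨e.source ∩ e ⁻¹' W, inter_mem (e.open_source.mem_nhds hps)
    ((e.continuousAt hps).preimage_mem_nhds (hWo.mem_nhds hWp)), fun c => ?_⟩
  refine ⟨{y | (c, y) ∈ W}, fun y => e.symm (c, y), hWo.preimage (by fun_prop), ?_, ?_, ?_⟩
  · intro y hy
    exact (hWs _ hy).2.1.fun_comp (analyticAt_const.prod analyticAt_id)
  · intro y hy
    refine ⟨(hWs _ hy).2.2, ?_⟩
    have h1 := e.right_inv (hWs _ hy).1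
    rw [hecoe] at h1
    exact congrArg Prod.fst h1
  · rintro x ⟨hx, hxW⟩ hc
    have h1 : e x = (c, P x) := by rw [hecoe, ← hc]
    refine ⟨P x, ?_, ?_⟩
    · have h2 : e x ∈ W := hxW
      rw [h1] at h2
      exact h2
    · show e.symm (c, P x) = x
      rw [← h1, e.left_inv hx]

lemma finrank_ker_lt {E : Type} [NormedAddCommGroup E] [NormedSpace ℂ E] [FiniteDimensional ℂ E]
    (l : E →L[ℂ] ℂ) (hl : l ≠ 0) : Module.finrank ℂ l.ker < Module.finrank ℂ E := by
  apply Submodule.finrank_lt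
  intro h
  apply hl
  ext x
  have : x ∈ l.ker := by rw [h]; trivial
  exact this

lemma exists_functional {E F : Type} [NormedAddCommGroup E] [NormedSpace ℂ E]
    [NormedAddCommGroup F] [NormedSpace ℂ F] (T : E →L[ℂ] F) (hT : T ≠ 0) :
    ∃ (μ : F →L[ℂ] ℂ) (v : E), μ (T v) = 1 := by
  obtain ⟨v, hv⟩ : ∃ v, T v ≠ 0 := by
    by_contra! h
    exact hT (ContinuousLinearMap.ext h)
  obtain ⟨μ, hμ⟩ := SeparatingDual.exists_eq_one (R := ℂ) hv
  exact ⟨μ, v, hμ⟩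

/-- Analytic Sard theorem, Baire category version. -/
theorem analytic_sard (n : ℕ) : ∀ (E F : Type) [NormedAddCommGroup E] [NormedSpace ℂ E]
    [FiniteDimensional ℂ E] [NormedAddCommGroup F] [NormedSpace ℂ F] [FiniteDimensional ℂ F]
    [Nontrivial F] (_ : Module.finrank ℂ E = n) (U : Set E) (_ : IsOpen U) (f : E → F)
    (_ : AnalyticOnNhd ℂ f U),
    IsMeagre (f '' {x | x ∈ U ∧ ¬ Function.Surjective (fderiv ℂ f x)}) := by
  induction n using Nat.strong_induction_on with
  | _ n ih =>
  intro E F _ _ _ _ _ _ _ hE U hU f hf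
  have cE : CompleteSpace E := FiniteDimensional.complete ℂ E
  have cF : CompleteSpace F := FiniteDimensional.complete ℂ F
  have pE : ProperSpace E := FiniteDimensional.proper ℂ E
  have hdf : ContinuousOn (fderiv ℂ f) U := hf.fderiv.continuousOn
  -- the three pieces
  let S1 : Set E := {x | x ∈ U ∧ ¬ Function.Surjective (fderiv ℂ f x) ∧ fderiv ℂ f x ≠ 0}
  let Z : ℕ → Set E := fun k => {x | x ∈ U ∧ fderiv ℂ f x = 0 ∧ iteratedFDeriv ℂ k f x = 0 ∧
    iteratedFDeriv ℂ (k + 1) f x ≠ 0}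
  let L : Set E := {x | x ∈ U ∧ ∀ k, iteratedFDeriv ℂ (k + 1) f x = 0}
  have hcov : {x | x ∈ U ∧ ¬ Function.Surjective (fderiv ℂ f x)} ⊆ S1 ∪ (⋃ k, Z k) ∪ L := by
    rintro x ⟨hxU, hxs⟩
    by_cases h0 : fderiv ℂ f x = 0
    · by_cases hL : ∀ k, iteratedFDeriv ℂ (k + 1) f x = 0
      · exact Or.inr ⟨hxU, hL⟩
      · push Not at hL
        classical
        refine Or.inl (Or.inr (mem_iUnion.2 ?_))
        have h1 : iteratedFDeriv ℂ (0 + 1) f x = 0 := by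
          ext v
          simp [iteratedFDeriv_one_apply, h0]
        obtain ⟨k, hk⟩ : ∃ k, Nat.find hL = k + 1 := by
          refine Nat.exists_eq_succ_of_ne_zero fun h => ?_
          have := Nat.find_spec hL
          rw [h] at this
          exact this h1
        refine ⟨k + 1, hxU, h0, ?_, ?_⟩
        · by_contra h
          have := Nat.find_min' hL h
          omega
        · have := Nat.find_spec hL
          rwa [hk] at this
    · exact Or.inl (Or.inl ⟨hxU, hxs, h0⟩)
  -- locally constant part
  have hLm : IsMeagre (f '' L) := by
    apply isMeagre_image_of_local
    rintro p ⟨hpU, hpk⟩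
    obtain ⟨q, r, hq⟩ := hf p hpU
    refine ⟨Metric.eball p r, Metric.eball_mem_nhds p hq.r_pos, ?_⟩
    have hsing : IsMeagre ({f p} : Set F) := by
      have : (𝓝[≠] (f p)).NeBot := Module.punctured_nhds_neBot ℂ F (f p)
      apply IsNowhereDense.isMeagre
      rw [isClosed_singleton.isNowhereDense_iff]
      exact interior_singleton _
    refine hsing.mono ?_
    rintro _ ⟨x, ⟨-, hx⟩, rfl⟩
    have hx' : x - p ∈ Metric.eball (0 : E) r := by
      simpa [Metric.mem_eball, edist_eq_enorm_sub] using hx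
    have h1 := hq.hasSum_iteratedFDeriv hx'
    have h2 : HasSum (fun k : ℕ ↦ ((k.factorial : ℂ))⁻¹ • iteratedFDeriv ℂ k f p fun _ ↦ (x - p))
        (f p) := by
      have := hasSum_single (f := fun k : ℕ ↦ ((k.factorial : ℂ))⁻¹ •
        iteratedFDeriv ℂ k f p fun _ ↦ (x - p)) 0 (by
          intro k hk
          obtain ⟨j, rfl⟩ := Nat.exists_eq_succ_of_ne_zero hk
          simp [hpk j])
      simpa using this
    have h3 := h1.unique h2
    rw [add_sub_cancel] at h3
    exact h3
  -- finite order part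
  have hZm : ∀ k, IsMeagre (f '' Z k) := by
    intro k
    apply isMeagre_image_of_local
    rintro p ⟨hpU, hp0, hpk, hpk1⟩
    have hne : fderiv ℂ (iteratedFDeriv ℂ k f) p ≠ 0 := by
      intro h
      apply hpk1
      rw [iteratedFDeriv_succ_eq_comp_left, Function.comp_apply, h]
      exact LinearIsometryEquiv.map_zero _
    obtain ⟨μ, v, hμ⟩ := exists_functional _ hne
    have hka : AnalyticAt ℂ (iteratedFDeriv ℂ k f) p := hf.iteratedFDeriv k p hpU
    let w : E → ℂ := fun x => μ (iteratedFDeriv ℂ k f x)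
    have hw : AnalyticAt ℂ w p := (μ.analyticAt _).fun_comp hka
    have hwd : fderiv ℂ w p = μ.comp (fderiv ℂ (iteratedFDeriv ℂ k f) p) :=
      (μ.hasFDerivAt.comp p hka.differentiableAt.hasFDerivAt).fderiv
    have hwne : fderiv ℂ w p ≠ 0 := by
      intro h
      rw [hwd] at h
      have := congrArg (fun T : E →L[ℂ] ℂ => T v) h
      simp [hμ] at this
    obtain ⟨N, hN, hpar⟩ := level_param U hU w p hpU hw hwne
    obtain ⟨V, γ, hV, hγ, hγU, hsurj⟩ := hpar 0
    refine ⟨N, hN, ?_⟩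
    have key := ih _ (hE ▸ finrank_ker_lt _ hwne) (fderiv ℂ w p).ker F rfl V hV
      (fun y => f (γ y)) (fun y hy => (hf _ (hγU y hy).1).fun_comp (hγ y hy))
    refine key.mono ?_
    rintro _ ⟨x, ⟨⟨hxU, hx0, hxk, -⟩, hxN⟩, rfl⟩
    obtain ⟨y, hy, rfl⟩ := hsurj x hxN (by simp [w, hxk])
    refine ⟨y, ⟨hy, ?_⟩, rfl⟩
    have hder : fderiv ℂ (fun y => f (γ y)) y = (fderiv ℂ f (γ y)).comp (fderiv ℂ γ y) :=
      ((hf _ hxU).differentiableAt.hasFDerivAt.comp y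
        (hγ y hy).differentiableAt.hasFDerivAt).fderiv
    rw [hder, hx0]
    intro hs
    obtain ⟨z, hz⟩ := exists_ne (0 : F)
    obtain ⟨u, hu⟩ := hs z
    exact hz (by rw [← hu]; simp)
  -- nonzero derivative part
  have hSm : IsMeagre (f '' S1) := by
    apply isMeagre_image_of_local
    rintro p ⟨hpU, hps, hp0⟩
    obtain ⟨μ, v, hμ⟩ := exists_functional _ hp0
    set u : F := fderiv ℂ f p v with hu
    let w : E → ℂ := fun x => μ (f x)
    have hwd : ∀ x ∈ U, fderiv ℂ w x = μ.comp (fderiv ℂ f x) := fun x hx =>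
      (μ.hasFDerivAt.comp x (hf x hx).differentiableAt.hasFDerivAt).fderiv
    have hw : AnalyticAt ℂ w p := (μ.analyticAt _).fun_comp (hf p hpU)
    have hwne : fderiv ℂ w p ≠ 0 := by
      intro h
      rw [hwd p hpU] at h
      have := congrArg (fun T : E →L[ℂ] ℂ => T v) h
      simp [← hu, hμ] at this
    obtain ⟨N, hN, hpar⟩ := level_param U hU w p hpU hw hwne
    let r : ℂ →L[ℂ] F := ContinuousLinearMap.toSpanSingleton ℂ u
    have hr : Function.RightInverse r μ := by
      intro z
      simp [r, hμ]
    let P : F →L[ℂ] μ.ker := μ.projKerOfRightInverse r hr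
    have hP : ∀ y, ((P y : μ.ker) : F) = y - μ y • u := by
      intro y
      simp [P, r]
    have hnt : Nontrivial μ.ker := by
      by_contra hn
      rw [not_nontrivial_iff_subsingleton] at hn
      apply hps
      intro y
      have h1 : P y = 0 := Subsingleton.elim _ _
      have h2 := hP y
      rw [h1] at h2
      refine ⟨μ y • v, ?_⟩
      rw [map_smul, ← hu]
      exact (sub_eq_zero.1 h2.symm).symm
    -- a compact neighbourhood
    have hM : ∀ᶠ x in 𝓝 p, x ∈ N ∧ x ∈ U ∧ μ (fderiv ℂ f x v) ≠ 0 := by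
      refine (Filter.eventually_mem_set.2 hN).and ((hU.eventually_mem hpU).and ?_)
      have hc : ContinuousAt (fun x => μ (fderiv ℂ f x v)) p := by
        have h1 : ContinuousAt (fderiv ℂ f) p := hdf.continuousAt (hU.mem_nhds hpU)
        exact μ.continuous.continuousAt.comp' (h1.clm_apply continuousAt_const)
      apply hc.eventually_ne
      rw [← hu, hμ]
      exact one_ne_zero
    obtain ⟨ε, hε, hball⟩ := Metric.nhds_basis_closedBall.mem_iff.1 hM
    refine ⟨Metric.closedBall p ε, Metric.closedBall_mem_nhds p hε, ?_⟩
    let K : Set E := Metric.closedBall p ε ∩ fderiv ℂ f ⁻¹' {T | ¬ Function.Surjective T}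
    have hK : IsCompact K := by
      refine (isCompact_closedBall p ε).of_isClosed_subset ?_ inter_subset_left
      refine ContinuousOn.preimage_isClosed_of_isClosed ?_ Metric.isClosed_closedBall
        (isOpen_surjective_clm E F).isClosed_compl
      exact hdf.mono fun x hx => (hball hx).2.1
    have hfK : IsCompact (f '' K) := hK.image_of_continuousOn
      (hf.continuousOn.mono fun x hx => (hball hx.1).2.1)
    have hfm : IsMeagre (f '' K) := by
      apply IsNowhereDense.isMeagre
      rw [hfK.isClosed.isNowhereDense_iff]
      by_contra hne
      obtain ⟨y0, hy0⟩ := nonempty_iff_ne_empty.2 hne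
      obtain ⟨V, γ, hV, hγ, hγU, hsurj⟩ := hpar (μ y0)
      have key := ih _ (hE ▸ finrank_ker_lt _ hwne) (fderiv ℂ w p).ker μ.ker rfl V hV
        (fun y => P (f (γ y)))
        (fun y hy => (P.analyticAt _).fun_comp ((hf _ (hγU y hy).1).fun_comp (hγ y hy)))
      let B : Set μ.ker := (fun z : μ.ker => (z : F) + μ y0 • u) ⁻¹' interior (f '' K)
      have hBo : IsOpen B := isOpen_interior.preimage (by fun_prop)
      have hBn : B.Nonempty := ⟨P y0, by
        show ((P y0 : μ.ker) : F) + μ y0 • u ∈ interior (f '' K)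
        rw [hP, sub_add_cancel]
        exact hy0⟩
      have cK : CompleteSpace μ.ker := FiniteDimensional.complete ℂ _
      refine not_isMeagre_of_isOpen hBo hBn (key.mono ?_)
      intro z hz
      obtain ⟨x, ⟨hxb, hxs⟩, hfx⟩ := interior_subset hz
      have hfx' : f x = (z : F) + μ y0 • u := hfx
      have hz0 : μ (z : F) = 0 := z.2
      have hwx : w x = μ y0 := by
        simp only [w, hfx', map_add, map_smul, hz0, hμ]
        simp
      obtain ⟨hxN, hxU, hxv⟩ := hball hxb
      obtain ⟨y, hy, rfl⟩ := hsurj x hxN hwx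
      refine ⟨y, ⟨hy, ?_⟩, ?_⟩
      · intro hs
        apply hxs
        have hd1 : HasFDerivAt (fun y => f (γ y)) ((fderiv ℂ f (γ y)).comp (fderiv ℂ γ y)) y :=
          (hf _ hxU).differentiableAt.hasFDerivAt.comp y (hγ y hy).differentiableAt.hasFDerivAt
        have hd2 : fderiv ℂ (fun y => P (f (γ y))) y =
            P.comp ((fderiv ℂ f (γ y)).comp (fderiv ℂ γ y)) :=
          (P.hasFDerivAt.comp y hd1).fderiv
        have hd3 : μ.comp ((fderiv ℂ f (γ y)).comp (fderiv ℂ γ y)) = 0 := by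
          have h1 : HasFDerivAt (fun y => μ (f (γ y)))
              (μ.comp ((fderiv ℂ f (γ y)).comp (fderiv ℂ γ y))) y := μ.hasFDerivAt.comp y hd1
          have h2 : HasFDerivAt (fun y => μ (f (γ y)))
              (0 : (fderiv ℂ w p).ker →L[ℂ] ℂ) y := by
            refine (hasFDerivAt_const (μ y0) y).congr_of_eventuallyEq ?_
            filter_upwards [hV.mem_nhds hy] with y' hy'
            exact (hγU y' hy').2
          exact h1.unique h2
        rw [hd2] at hs
        intro t
        set D := fderiv ℂ f (γ y) with hD
        obtain ⟨s, hs⟩ := hs (P (t - (μ t / μ (D v)) • D v))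
        have e1 : μ (D (fderiv ℂ γ y s)) = 0 :=
          congrArg (fun T : (fderiv ℂ w p).ker →L[ℂ] ℂ => T s) hd3
        have e2 := congrArg (Subtype.val) hs
        have e3 : μ (t - (μ t / μ (D v)) • D v) = 0 := by
          simp [div_mul_cancel₀ _ hxv]
        simp only [ContinuousLinearMap.comp_apply] at e2
        rw [hP, hP, e1, e3] at e2
        simp only [zero_smul, sub_zero] at e2
        refine ⟨fderiv ℂ γ y s + (μ t / μ (D v)) • v, ?_⟩
        rw [map_add, map_smul, e2, sub_add_cancel]
      · apply Subtype.ext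
        show ((P (f (γ y)) : μ.ker) : F) = z
        have hwx' : μ (f (γ y)) = μ y0 := hwx
        rw [hP, hwx', hfx', add_sub_cancel_right]
    refine hfm.mono (image_mono ?_)
    rintro x ⟨⟨-, hxs, -⟩, hxb⟩
    exact ⟨hxb, hxs⟩
  refine ((hSm.union (isMeagre_iUnion hZm)).union hLm).mono ?_
  rw [← image_iUnion, ← image_union, ← image_union]
  exact image_mono hcov

/-- If `f : U → ℂᵐ` is a `ℂ`-analytic map on a nonempty connected open set `U ⊆ ℂⁿ`
whose image has nonempty interior, then the set of points of `U` where the Fréchet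
derivative of `f` is surjective is dense in `U`. -/
theorem submersion_points_dense
    (n m : ℕ) (hn : 0 < n) (hm : 0 < m)
    (U : Set (Fin n → ℂ)) (hUopen : IsOpen U) (hUconn : IsConnected U)
    (f : (Fin n → ℂ) → (Fin m → ℂ)) (hf : AnalyticOnNhd ℂ f U)
    (himg : (interior (f '' U)).Nonempty) :
    U ⊆ closure {x ∈ U | Function.Surjective (fderiv ℂ f x)} := by
  classical
  have : Nonempty (Fin m) := ⟨⟨0, hm⟩⟩
  by_contra hnot
  obtain ⟨p, hpU, hp⟩ := not_subset.1 hnot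
  have hev : ∀ᶠ x in 𝓝 p, ¬ Function.Surjective (fderiv ℂ f x) := by
    rw [mem_closure_iff_frequently, not_frequently] at hp
    filter_upwards [hp, hUopen.mem_nhds hpU] with x hx hxU hs
    exact hx ⟨hxU, hs⟩
  have hall : ∀ q ∈ U, ¬ Function.Surjective (fderiv ℂ f q) := by
    intro q hq hs
    choose R hR using fun j : Fin m => hs (Pi.single j 1)
    let M : (Fin n → ℂ) → Matrix (Fin m) (Fin m) ℂ := fun x =>
      Matrix.of fun i j => fderiv ℂ f x (R j) i
    have hMa : AnalyticOnNhd ℂ (fun x => (M x).det) U := by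
      simp only [Matrix.det_apply']
      refine Finset.analyticOnNhd_fun_sum _ fun σ _ => ?_
      refine analyticOnNhd_const.mul (Finset.analyticOnNhd_fun_prod _ fun i _ => ?_)
      intro x hx
      have h1 : AnalyticAt ℂ (fderiv ℂ f) x := hf.fderiv x hx
      exact (((ContinuousLinearMap.proj (R := ℂ) (φ := fun _ : Fin m => ℂ) (σ i)).comp
        (ContinuousLinearMap.apply ℂ (Fin m → ℂ) (R i))).analyticAt _).fun_comp h1
    have hz : (fun x => (M x).det) =ᶠ[𝓝 p] fun _ => 0 := by
      filter_upwards [hev] with x hx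
      by_contra hdet
      apply hx
      intro t
      have hu : IsUnit (M x).det := isUnit_iff_ne_zero.2 hdet
      refine ⟨∑ j, ((M x)⁻¹.mulVec t) j • R j, ?_⟩
      have h1 : (M x).mulVec ((M x)⁻¹.mulVec t) = t := by
        rw [Matrix.mulVec_mulVec, Matrix.mul_nonsing_inv _ hu, Matrix.one_mulVec]
      rw [map_sum]
      ext i
      conv_rhs => rw [← h1]
      simp [Matrix.mulVec, dotProduct, M, mul_comm]
    have hq0 := hMa.eqOn_of_preconnected_of_eventuallyEq analyticOnNhd_const
      hUconn.isPreconnected hpU hz hq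
    have hM1 : M q = 1 := by
      ext i j
      simp [M, hR, Matrix.one_apply, Pi.single_apply]
    simp [hM1] at hq0
  have hmg := analytic_sard n (Fin n → ℂ) (Fin m → ℂ) (by simp) U hUopen f hf
  refine not_isMeagre_of_isOpen isOpen_interior himg (hmg.mono ?_)
  refine interior_subset.trans (image_mono fun x hx => ⟨hx, hall x hx⟩)
end

section
/- Let n, m be positive integers, let U ⊆ ℂⁿ be an open set, and let f : U → ℂᵐ be a ℂ-analytic map such that for every x ∈ U the Fréchet derivative Df(x) : ℂⁿ → ℂᵐ is not surjective. Then the image f(U) has empty interior in ℂᵐ. -/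
open Set Filter Topology

/-- Analytic parametrization of a level set near a regular point. -/
lemma param_level {n : ℕ} (g : (Fin (n + 1) → ℂ) → ℂ) (x : Fin (n + 1) → ℂ)
    (hg : AnalyticAt ℂ g x) (hdg : fderiv ℂ g x ≠ 0) (U : Set (Fin (n + 1) → ℂ))
    (hU : IsOpen U) (hx : x ∈ U) :
    ∃ W ∈ 𝓝 x, ∃ B : Set (Fin n → ℂ), IsOpen B ∧ ∃ φ : (Fin n → ℂ) → (Fin (n + 1) → ℂ),
      AnalyticOnNhd ℂ φ B ∧ MapsTo φ B U ∧ (∀ b ∈ B, g (φ b) = g x) ∧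
      ∀ y ∈ W, g y = g x → y ∈ φ '' B := by
  obtain ⟨i, hi⟩ : ∃ i : Fin (n + 1), fderiv ℂ g x (Pi.single i 1) ≠ 0 := by
    by_contra! h
    apply hdg
    ext v
    rw [pi_eq_sum_univ' v, map_sum]
    simp [h]
  let e : Fin (n + 1) → ℂ := Pi.single i 1
  let Φ : (Fin (n + 1) → ℂ) → (Fin (n + 1) → ℂ) := fun y => y + (g y - y i) • e
  let A : (Fin (n + 1) → ℂ) →L[ℂ] (Fin (n + 1) → ℂ) :=
    ContinuousLinearMap.id ℂ _ +
      (fderiv ℂ g x - ContinuousLinearMap.proj (R := ℂ) (φ := fun _ : Fin (n + 1) => ℂ) i).smulRight e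
  have hΦ : AnalyticAt ℂ Φ x := by
    have h1 : AnalyticAt ℂ (fun y : Fin (n + 1) → ℂ => y i) x :=
      (ContinuousLinearMap.proj (R := ℂ) (φ := fun _ : Fin (n + 1) => ℂ) i).analyticAt x
    exact analyticAt_id.add ((hg.sub h1).smul analyticAt_const)
  have hA : HasFDerivAt Φ A x := by
    have h1 : HasFDerivAt (fun y : Fin (n + 1) → ℂ => y i)
      (ContinuousLinearMap.proj (R := ℂ) (φ := fun _ : Fin (n + 1) => ℂ) i) x :=
      (ContinuousLinearMap.proj (R := ℂ) (φ := fun _ : Fin (n + 1) => ℂ) i).hasFDerivAt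
    exact (hasFDerivAt_id x).add ((hg.differentiableAt.hasFDerivAt.sub h1).smul_const e)
  have hAinj : Function.Injective A := by
    rw [injective_iff_map_eq_zero]
    intro v hv
    have hv1 : v + (fderiv ℂ g x v - v i) • e = 0 := by simpa [A] using hv
    have h2 : fderiv ℂ g x v = 0 := by
      have := congrFun hv1 i
      simpa [e] using this
    rw [h2] at hv1
    have h3 : v = v i • e := by
      rw [zero_sub, neg_smul] at hv1
      exact add_neg_eq_zero.mp hv1
    have h4 : v i = 0 := by
      rw [h3, map_smul, smul_eq_mul] at h2
      exact (mul_eq_zero.mp h2).resolve_right hi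
    rw [h3, h4, zero_smul]
  let A' : (Fin (n + 1) → ℂ) ≃L[ℂ] (Fin (n + 1) → ℂ) :=
    (LinearEquiv.ofInjectiveEndo (A : (Fin (n + 1) → ℂ) →ₗ[ℂ] (Fin (n + 1) → ℂ))
      hAinj).toContinuousLinearEquiv
  have hA' : HasFDerivAt Φ (A' : (Fin (n + 1) → ℂ) →L[ℂ] (Fin (n + 1) → ℂ)) x := by
    convert hA using 1
    ext v : 1
    rfl
  have hC : ContDiffAt ℂ ⊤ Φ x := hΦ.contDiffAt
  have htop : (⊤ : WithTop ℕ∞) ≠ 0 := by simp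
  let R := hC.toOpenPartialHomeomorph Φ hA' htop
  have hRx : x ∈ R.source := hC.mem_toOpenPartialHomeomorph_source hA' htop
  have hRxt : Φ x ∈ R.target := hC.image_mem_toOpenPartialHomeomorph_target hA' htop
  have hRcoe : ∀ y, R y = Φ y := fun _ => rfl
  have hψ : AnalyticAt ℂ R.symm (Φ x) :=
    (hC.to_localInverse hA' htop).analyticAt
  have hRsx : R.symm (Φ x) = x := R.left_inv hRx
  have hev : ∀ᶠ z in 𝓝 (Φ x), AnalyticAt ℂ R.symm z ∧ R.symm z ∈ U ∧ z ∈ R.target := by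
    refine hψ.eventually_analyticAt.and (Filter.Eventually.and ?_ (R.open_target.mem_nhds hRxt))
    apply hψ.continuousAt.eventually_mem
    rw [hRsx]
    exact hU.mem_nhds hx
  obtain ⟨O, hO, hOopen, hxO⟩ := eventually_nhds_iff.mp hev
  let ins : (Fin n → ℂ) → (Fin (n + 1) → ℂ) := fun b => i.insertNth (g x) b
  have hins : AnalyticOnNhd ℂ ins univ := by
    rw [analyticOnNhd_pi_iff]
    intro j
    refine Fin.succAboveCases i ?_ (fun k => ?_) j
    · simpa [ins] using analyticOnNhd_const
    · simp only [ins, Fin.insertNth_apply_succAbove]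
      exact (ContinuousLinearMap.proj (R := ℂ) (φ := fun _ : Fin n => ℂ) k).analyticOnNhd _
  have hinsc : Continuous ins := by
    rw [← continuousOn_univ]; exact hins.continuousOn
  refine ⟨R.source ∩ Φ ⁻¹' O, inter_mem (R.open_source.mem_nhds hRx)
    (hΦ.continuousAt.preimage_mem_nhds (hOopen.mem_nhds hxO)),
    ins ⁻¹' O, hOopen.preimage hinsc, fun b => R.symm (ins b), ?_, ?_, ?_, ?_⟩
  · intro b hb
    exact (hO _ hb).1.comp (hins b (mem_univ _))
  · intro b hb
    exact (hO _ hb).2.1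
  · intro b hb
    have h1 : Φ (R.symm (ins b)) = ins b := R.right_inv (hO _ hb).2.2
    have h2 := congrFun h1 i
    simpa [Φ, e, ins] using h2
  · rintro y ⟨hy1, hy2⟩ hgy
    have h1 : ins (i.removeNth y) = Φ y := by
      ext j
      refine Fin.succAboveCases i ?_ (fun k => ?_) j
      · simp [ins, Φ, e, hgy]
      · simp [ins, Φ, e, Fin.removeNth]
    refine ⟨i.removeNth y, ?_, ?_⟩
    · change ins _ ∈ O
      rw [h1]; exact hy2
    · change R.symm (ins _) = y
      rw [h1]; exact R.left_inv hy1

/-- Countability of images is a local property. -/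
lemma countable_image_of_local {E F : Type*} [TopologicalSpace E] [SecondCountableTopology E]
    (f : E → F) (S : Set E) (h : ∀ x ∈ S, ∃ W ∈ 𝓝 x, (f '' (W ∩ S)).Countable) :
    (f '' S).Countable := by
  choose! W hW hc using h
  obtain ⟨t, htS, htc, hcov⟩ := TopologicalSpace.countable_cover_nhdsWithin
    (fun x hx => mem_nhdsWithin_of_mem_nhds (hW x hx))
  refine (htc.biUnion (fun x hx => hc x (htS hx))).mono ?_
  rintro _ ⟨y, hy, rfl⟩
  obtain ⟨x, hx, hyx⟩ := mem_iUnion₂.mp (hcov hy)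
  exact mem_iUnion₂.mpr ⟨x, hx, y, ⟨hyx, hy⟩, rfl⟩

/-- Sard's theorem for scalar analytic functions: countably many critical values. -/
lemma scalar_sard (n : ℕ) : ∀ (U : Set (Fin n → ℂ)), IsOpen U → ∀ f : (Fin n → ℂ) → ℂ,
    AnalyticOnNhd ℂ f U → (f '' {x ∈ U | fderiv ℂ f x = 0}).Countable := by
  induction n with
  | zero =>
    intro U _ f _
    exact (Set.subsingleton_of_subsingleton.image f).countable
  | succ n ih =>
    intro U hU f hf
    let S : ℕ → Set (Fin (n + 1) → ℂ) := fun k => {x | x ∈ U ∧ fderiv ℂ f x = 0 ∧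
      iteratedFDeriv ℂ (k + 1) f x = 0 ∧ iteratedFDeriv ℂ (k + 2) f x ≠ 0}
    let T : Set (Fin (n + 1) → ℂ) := {x | x ∈ U ∧ ∀ k, iteratedFDeriv ℂ (k + 1) f x = 0}
    have hT : (f '' T).Countable := by
      apply countable_image_of_local
      rintro x ⟨hxU, hx⟩
      obtain ⟨p, r, hp⟩ := hf x hxU
      refine ⟨Metric.eball x r, Metric.eball_mem_nhds x hp.r_pos, ?_⟩
      refine (countable_singleton (f x)).mono ?_
      rintro _ ⟨y, ⟨hy, -⟩, rfl⟩
      have hy' : y - x ∈ Metric.eball (0 : Fin (n + 1) → ℂ) r := by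
        simpa [edist_eq_enorm_sub] using hy
      have h1 := hp.hasSum_iteratedFDeriv hy'
      have h2 := hasSum_single (f := fun n ↦ ((Nat.factorial n : ℕ) : ℂ)⁻¹ •
        iteratedFDeriv ℂ n f x fun _ ↦ (y - x)) 0 (by
          intro k hk
          obtain ⟨k, rfl⟩ := Nat.exists_eq_succ_of_ne_zero hk
          simp [hx k])
      have h3 := h1.unique h2
      simpa using h3
    have hS : ∀ k, (f '' S k).Countable := by
      intro k
      apply countable_image_of_local
      rintro x ⟨hxU, -, hx0, hx1⟩
      obtain ⟨v, hv⟩ : ∃ v, iteratedFDeriv ℂ (k + 2) f x v ≠ 0 := by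
        by_contra! h
        exact hx1 (by ext v; simpa using h v)
      have hD := hf.iteratedFDeriv (k + 1)
      let L := ContinuousMultilinearMap.apply ℂ (fun _ : Fin (k + 1) => (Fin (n + 1) → ℂ)) ℂ
        (Fin.tail v)
      let g : (Fin (n + 1) → ℂ) → ℂ := fun y => L (iteratedFDeriv ℂ (k + 1) f y)
      have hg : AnalyticAt ℂ g x := (L.analyticAt _).comp (hD x hxU)
      have hdg : fderiv ℂ g x ≠ 0 := by
        intro h0
        apply hv
        have h1 : HasFDerivAt g (L.comp (fderiv ℂ (iteratedFDeriv ℂ (k + 1) f) x)) x :=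
          L.hasFDerivAt.comp x (hD x hxU).differentiableAt.hasFDerivAt
        rw [h1.fderiv] at h0
        rw [iteratedFDeriv_succ_apply_left]
        exact DFunLike.congr_fun h0 (v 0)
      obtain ⟨W, hW, B, hB, φ, hφ, hφU, hφg, hWφ⟩ := param_level g x hg hdg U hU hxU
      refine ⟨W, hW, (ih B hB (f ∘ φ) (hf.comp hφ hφU)).mono ?_⟩
      rintro _ ⟨y, ⟨hyW, hyU, hy0, hyk, -⟩, rfl⟩
      obtain ⟨b, hb, rfl⟩ := hWφ y hyW (by simp [g, hx0, hyk])
      refine ⟨b, ⟨hb, ?_⟩, rfl⟩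
      rw [fderiv_comp b (hf _ hyU).differentiableAt (hφ b hb).differentiableAt, hy0]
      simp
    refine (hT.union (countable_iUnion hS)).mono ?_
    rintro _ ⟨x, ⟨hxU, hx0⟩, rfl⟩
    by_cases h : ∃ k, x ∈ S k
    · obtain ⟨k, hk⟩ := h
      exact Or.inr (mem_iUnion.mpr ⟨k, x, hk, rfl⟩)
    · refine Or.inl ⟨x, ⟨hxU, fun k => ?_⟩, rfl⟩
      push Not at h
      induction k with
      | zero =>
        ext v
        rw [iteratedFDeriv_one_apply, hx0]
        simp
      | succ k ihk =>
        by_contra hne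
        exact h k ⟨hxU, hx0, ihk, hne⟩

/-- Images of nowhere submersive analytic maps. -/
def CritImage (m : ℕ) (A : Set (Fin m → ℂ)) : Prop :=
  ∃ (n : ℕ) (U : Set (Fin n → ℂ)) (f : (Fin n → ℂ) → (Fin m → ℂ)), IsOpen U ∧
    AnalyticOnNhd ℂ f U ∧ (∀ x ∈ U, ¬ Function.Surjective (fderiv ℂ f x)) ∧ A = f '' U

lemma slice_step (m : ℕ) (A : Set (Fin (m + 1) → ℂ)) (hA : CritImage (m + 1) A) :
    ∃ K : Set ℂ, K.Countable ∧ ∀ c ∉ K, ∃ T : Set (Set (Fin m → ℂ)), T.Countable ∧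
      (∀ D ∈ T, CritImage m D) ∧ ∀ w : Fin m → ℂ, (Fin.cons c w : Fin (m + 1) → ℂ) ∈ A → w ∈ ⋃₀ T := by
  obtain ⟨n, U, f, hU, hf, hcrit, rfl⟩ := hA
  have hf0 : AnalyticOnNhd ℂ (fun x => f x 0) U := (analyticOnNhd_pi_iff.mp hf) 0
  refine ⟨_, scalar_sard n U hU _ hf0, fun c hc => ?_⟩
  have hreg : ∀ x ∈ U, f x 0 = c → fderiv ℂ (fun x => f x 0) x ≠ 0 := by
    intro x hx hxc h0
    exact hc ⟨x, ⟨hx, h0⟩, hxc⟩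
  rcases n with _ | n
  · refine ⟨∅, countable_empty, by simp, ?_⟩
    rintro w ⟨x, hx, hxw⟩
    exact absurd (Subsingleton.elim _ _) (hreg x hx (by rw [hxw]; rfl))
  let Z : Set (Fin (n + 1) → ℂ) := {x | x ∈ U ∧ f x 0 = c}
  let ft : (Fin (n + 1) → ℂ) → (Fin m → ℂ) := fun x => Fin.tail (f x)
  have hft : AnalyticOnNhd ℂ ft U := by
    rw [analyticOnNhd_pi_iff]
    intro j
    exact (analyticOnNhd_pi_iff.mp hf) j.succ
  have hloc : ∀ x ∈ Z, ∃ W ∈ 𝓝 x, ∃ D, CritImage m D ∧ ft '' (W ∩ Z) ⊆ D := by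
    rintro x ⟨hxU, hxc⟩
    obtain ⟨W, hW, B, hB, φ, hφ, hφU, hφg, hWφ⟩ :=
      param_level (fun x => f x 0) x (hf0 x hxU) (hreg x hxU hxc) U hU hxU
    refine ⟨W, hW, _, ⟨n, B, ft ∘ φ, hB, hft.comp hφ hφU, ?_, rfl⟩, ?_⟩
    · intro b hb hsurj
      have hbU := hφU hb
      apply hcrit _ hbU
      have hd0 := hreg _ hbU ((hφg b hb).trans hxc)
      have hcomp0 : (fderiv ℂ (fun x => f x 0) (φ b)).comp (fderiv ℂ φ b) = 0 := by
        rw [← fderiv_comp b (hf0 _ hbU).differentiableAt (hφ b hb).differentiableAt]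
        have : ((fun x => f x 0) ∘ φ) =ᶠ[𝓝 b] fun _ => f x 0 := by
          filter_upwards [hB.mem_nhds hb] with b' hb'
          exact hφg b' hb'
        rw [this.fderiv_eq]
        simp
      rw [fderiv_comp b (hft _ hbU).differentiableAt (hφ b hb).differentiableAt] at hsurj
      have hfd : HasFDerivAt f (fderiv ℂ f (φ b)) (φ b) :=
        (hf _ hbU).differentiableAt.hasFDerivAt
      have hpi := hasFDerivAt_pi'.mp hfd
      have e0 : ∀ v, fderiv ℂ (fun x => f x 0) (φ b) v = fderiv ℂ f (φ b) v 0 := by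
        intro v
        rw [(hpi 0).fderiv]
        rfl
      have et : ∀ v j, fderiv ℂ ft (φ b) v j = fderiv ℂ f (φ b) v (Fin.succ j) := by
        intro v j
        have h1 := hasFDerivAt_pi'.mp (hft _ hbU).differentiableAt.hasFDerivAt j
        have h2 := h1.unique (hpi j.succ)
        exact DFunLike.congr_fun h2 v
      intro z
      obtain ⟨u, hu⟩ : ∃ u, fderiv ℂ (fun x => f x 0) (φ b) u ≠ 0 := by
        by_contra! h
        exact hd0 (ContinuousLinearMap.ext h)
      let u' := (z 0 / fderiv ℂ (fun x => f x 0) (φ b) u) • u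
      have hu' : fderiv ℂ (fun x => f x 0) (φ b) u' = z 0 := by
        simp only [u', map_smul, smul_eq_mul]
        field_simp
      obtain ⟨v, hv⟩ := hsurj (Fin.tail z - fderiv ℂ ft (φ b) u')
      have hv0 : fderiv ℂ (fun x => f x 0) (φ b) (fderiv ℂ φ b v) = 0 :=
        DFunLike.congr_fun hcomp0 v
      refine ⟨u' + fderiv ℂ φ b v, ?_⟩
      ext j
      refine Fin.cases ?_ (fun j => ?_) j
      · rw [← e0, map_add, hu', hv0, add_zero]
      · rw [← et, map_add]
        have : fderiv ℂ ft (φ b) (fderiv ℂ φ b v) = Fin.tail z - fderiv ℂ ft (φ b) u' := hv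
        rw [this]
        simp [Fin.tail]
    · rintro _ ⟨y, ⟨hyW, hyU, hyc⟩, rfl⟩
      obtain ⟨b, hb, rfl⟩ := hWφ y hyW (hyc.trans hxc.symm)
      exact ⟨b, hb, rfl⟩
  choose! W hW D hD hWD using hloc
  obtain ⟨t, htS, htc, hcov⟩ := TopologicalSpace.countable_cover_nhdsWithin
    (fun x hx => mem_nhdsWithin_of_mem_nhds (hW x hx))
  refine ⟨D '' t, htc.image D, ?_, ?_⟩
  · rintro _ ⟨x, hx, rfl⟩
    exact hD x (htS hx)
  · rintro w ⟨y, hy, hyw⟩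
    have hyZ : y ∈ Z := ⟨hy, by rw [hyw]; rfl⟩
    obtain ⟨x, hx, hyx⟩ := mem_iUnion₂.mp (hcov hyZ)
    refine ⟨D x, ⟨x, hx, rfl⟩, hWD x (htS hx) ⟨y, ⟨hyx, hyZ⟩, ?_⟩⟩
    change Fin.tail (f y) = w
    rw [hyw, Fin.tail_cons]

lemma interior_family (m : ℕ) : ∀ T : Set (Set (Fin m → ℂ)), T.Countable →
    (∀ A ∈ T, CritImage m A) → interior (⋃₀ T) = ∅ := by
  induction m with
  | zero =>
    intro T _ hT
    rw [← subset_empty_iff]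
    intro z hz
    obtain ⟨A, hA, hzA⟩ := interior_subset hz
    obtain ⟨n, U, f, -, -, hcrit, rfl⟩ := hT A hA
    obtain ⟨x, hx, -⟩ := hzA
    exact hcrit x hx (fun w => ⟨0, Subsingleton.elim _ _⟩)
  | succ m ih =>
    intro T hTc hT
    by_contra hne
    obtain ⟨z, hz⟩ := nonempty_iff_ne_empty.mpr hne
    have hstep := fun A hA => slice_step m A (hT A hA)
    choose! K hKc hK using hstep
    have hKK : (⋃ A ∈ T, K A).Countable := hTc.biUnion hKc
    have hdense := hKK.dense_compl ℂ
    have hcont1 : Continuous (fun c : ℂ => (Fin.cons c (Fin.tail z) : Fin (m + 1) → ℂ)) := by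
      fun_prop
    obtain ⟨c, hcV, hcK⟩ := hdense.inter_open_nonempty _
      (isOpen_interior.preimage hcont1) ⟨z 0, by
        change (Fin.cons (z 0) (Fin.tail z) : Fin (m + 1) → ℂ) ∈ interior (⋃₀ T)
        rw [Fin.cons_self_tail]; exact hz⟩
    have hcK' : ∀ A ∈ T, c ∉ K A := fun A hA h => hcK (mem_iUnion₂.mpr ⟨A, hA, h⟩)
    have hK2 := fun A hA => hK A hA c (hcK' A hA)
    choose! Q hQc hQ hQs using hK2
    have h0 := ih (⋃ A ∈ T, Q A) (hTc.biUnion hQc) (by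
      intro D hD
      obtain ⟨A, hA, hDA⟩ := mem_iUnion₂.mp hD
      exact hQ A hA D hDA)
    have hcont2 : Continuous (fun w : Fin m → ℂ => (Fin.cons c w : Fin (m + 1) → ℂ)) := by
      fun_prop
    have hsub : (fun w : Fin m → ℂ => (Fin.cons c w : Fin (m + 1) → ℂ)) ⁻¹' interior (⋃₀ T) ⊆
        interior (⋃₀ (⋃ A ∈ T, Q A)) := by
      apply interior_maximal _ (isOpen_interior.preimage hcont2)
      intro w hw
      obtain ⟨A, hA, hwA⟩ := interior_subset hw
      obtain ⟨D, hD, hwD⟩ := hQs A hA w hwA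
      exact ⟨D, mem_iUnion₂.mpr ⟨A, hA, hD⟩, hwD⟩
    rw [h0] at hsub
    exact hsub hcV

/-- If a `ℂ`-analytic map `f : U → ℂᵐ` on an open set `U ⊆ ℂⁿ` has nowhere surjective
Fréchet derivative, then its image `f(U)` has empty interior in `ℂᵐ`. -/
theorem interior_image_eq_empty_of_nowhere_submersion
    (n m : ℕ) (hn : 0 < n) (hm : 0 < m)
    (U : Set (Fin n → ℂ)) (hUopen : IsOpen U)
    (f : (Fin n → ℂ) → (Fin m → ℂ)) (hf : AnalyticOnNhd ℂ f U)
    (hcrit : ∀ x ∈ U, ¬ Function.Surjective (fderiv ℂ f x)) :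
    interior (f '' U) = ∅ := by
  have h := interior_family m {f '' U} (countable_singleton _) (by
    rintro A rfl
    exact ⟨n, U, f, hUopen, hf, hcrit, rfl⟩)
  rwa [sUnion_singleton] at h
end
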